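/- Let T_0 ∈ (0, π]. For T ≥ T_0 define C(T) := r((0, T_0)) ∪ r((T_0, T) − π) ⊆ ℝ/(2πℤ). Then inf { T ≥ T_0 : μ( (C(T))ᶜ ) = 0 } = 2π + T_0. -/

import Mathlib

open MeasureTheory Set Real Filter Topology

noncomputable section

instance : Fact (0 < 2 * Real.pi) := ⟨by positivity⟩

/-- The covered set C(T) ⊆ ℝ/(2πℤ) for a single exchange of the observation
endpoint: observation at x = 0 on (0,T₀) and at x = π on (T₀,T), i.e.
C(T) = r((0,T₀)) ∪ r((T₀,T) − π). -/
def covSingle (T0 T : ℝ) : Set (AddCircle (2 * Real.pi)) :=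
  ((fun x : ℝ => ((x : ℝ) : AddCircle (2 * Real.pi))) '' Set.Ioo 0 T0) ∪
  ((fun x : ℝ => ((x - Real.pi : ℝ) : AddCircle (2 * Real.pi))) '' Set.Ioo T0 T)

/-- Corollary 1.9, second part: for 0 < T₀ ≤ π, the optimal control time for a
single exchange of the observation endpoint at time T₀ is 2π + T₀. -/
theorem stmt_6 (T0 : ℝ) (hT0 : T0 ∈ Set.Ioc 0 Real.pi) :
    sInf { T : ℝ | T0 ≤ T ∧ volume (covSingle T0 T)ᶜ = 0 } = 2 * Real.pi + T0 := by
  obtain ⟨h0, h1⟩ := hT0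
  have hmem : ∀ T : ℝ, 2 * Real.pi + T0 < T →
      T ∈ { T : ℝ | T0 ≤ T ∧ volume (covSingle T0 T)ᶜ = 0 } := by
    intro T hT
    refine ⟨by linarith [Real.pi_pos], ?_⟩
    have huniv : covSingle T0 T = Set.univ := by
      refine Set.eq_univ_of_forall fun z => ?_
      obtain ⟨y, hy, rfl⟩ : z ∈ ((↑) : ℝ → AddCircle (2 * Real.pi)) ''
          Set.Ioc (T0 - Real.pi) (T0 - Real.pi + 2 * Real.pi) := by
        rw [AddCircle.coe_image_Ioc_eq]; trivial
      refine Or.inr ⟨y + Real.pi, ⟨by linarith [hy.1], by linarith [hy.2]⟩, ?_⟩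
      simp
    rw [huniv]; simp
  have hlow : ∀ T ∈ { T : ℝ | T0 ≤ T ∧ volume (covSingle T0 T)ᶜ = 0 },
      2 * Real.pi + T0 ≤ T := by
    rintro T ⟨hT, hv⟩
    by_contra hlt
    push Not at hlt
    have key : ∀ x y : ℝ, (x : AddCircle (2 * Real.pi)) = (y : AddCircle (2 * Real.pi)) →
        y < x → x - y < 2 * Real.pi → False := by
      intro x y h hyx hxy
      obtain ⟨n, hn⟩ := (AddCircle.coe_eq_zero_iff (2 * Real.pi) (x := x - y)).1 (by
        rw [AddCircle.coe_sub, h, sub_self])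
      rw [zsmul_eq_mul] at hn
      have hp := Real.pi_pos
      have a1 : (0 : ℝ) < n := by
        by_contra hc
        push Not at hc
        nlinarith
      have a2 : (n : ℝ) < 1 := by
        by_contra hc
        push Not at hc
        nlinarith
      have b1 : (0 : ℤ) < n := by exact_mod_cast a1
      have b2 : n < (1 : ℤ) := by exact_mod_cast a2
      omega
    have hsub : ((↑) : ℝ → AddCircle (2 * Real.pi)) ''
        Set.Ioo (max (T - Real.pi) T0) (T0 + Real.pi) ⊆ (covSingle T0 T)ᶜ := by
      rintro _ ⟨x, ⟨hx1, hx2⟩, rfl⟩ hc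
      have hx3 := lt_of_le_of_lt (le_max_left _ _) hx1
      have hx4 := lt_of_le_of_lt (le_max_right _ _) hx1
      rcases hc with ⟨y, hy, hxy⟩ | ⟨y, hy, hxy⟩
      · exact key x y hxy.symm (by linarith [hy.2]) (by linarith [hy.1])
      · exact key x (y - Real.pi) hxy.symm (by linarith [hy.2]) (by linarith [hy.1])
    have hopen : IsOpen (((↑) : ℝ → AddCircle (2 * Real.pi)) ''
        Set.Ioo (max (T - Real.pi) T0) (T0 + Real.pi)) :=
      QuotientAddGroup.isOpenMap_coe _ isOpen_Ioo
    have hne : (((↑) : ℝ → AddCircle (2 * Real.pi)) ''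
        Set.Ioo (max (T - Real.pi) T0) (T0 + Real.pi)).Nonempty :=
      (Set.nonempty_Ioo.2 (max_lt (by linarith) (by linarith [Real.pi_pos]))).image _
    exact (hopen.measure_pos volume hne).ne' (measure_mono_null hsub hv)
  refine le_antisymm ?_ (le_csInf ⟨_, hmem (2 * Real.pi + T0 + 1) (by linarith)⟩ hlow)
  refine le_of_forall_gt_imp_ge_of_dense fun T hT => ?_
  exact csInf_le ⟨_, hlow⟩ (hmem T hT)
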